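/- Let ✶^∁ be the dual of the operation ✶, i.e., f ✶^∁ g = ¬((¬f) ✶ (¬g)) where (¬f)(x) = f(1-x). Then ✶^∁ is a t_r-conorm on L, and it cannot be obtained by the convolution formulas: for any binary operation * on I and any t-norm Δ on I there exist f, g ∈ L with f ✶^∁ g ≠ f⋏g, and for any binary operation * on I and any t-conorm ∇ on I there exist f, g ∈ L with f ✶^∁ g ≠ f⋎g, where (f⋏g)(x) = sup{f(y)*g(z) : y Δ z = x} and (f⋎g)(x) = sup{f(y)*g(z) : y ∇ z = x}. -/

import Mathlib

noncomputable section

attribute [local instance] Classical.propDecidable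

instance : Fact ((0:ℝ) ≤ 1) := ⟨zero_le_one⟩

/-- The unit interval `I = [0,1]`. -/
abbrev I01 := unitInterval

/-- `f^L (x) = sup {f y | y ≤ x}`. -/
def funL (f : I01 → I01) (x : I01) : I01 := sSup (f '' {y | y ≤ x})

/-- `f^R (x) = sup {f y | y ≥ x}`. -/
def funR (f : I01 → I01) (x : I01) : I01 := sSup (f '' {y | x ≤ y})

/-- `f^{Lw}`. -/
def funLw (f : I01 → I01) (x : I01) : I01 :=
  if x = 0 then f 0 else sSup (f '' {y | y < x})

/-- A function is normal if `sup {f x | x ∈ I} = 1`. -/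
def NormalFn (f : I01 → I01) : Prop := sSup (Set.range f) = 1

/-- A function is convex in the fuzzy sense. -/
def ConvexFn (f : I01 → I01) : Prop :=
  ∀ x y z : I01, x ≤ y → y ≤ z → min (f x) (f z) ≤ f y

/-- `L`, the set of all normal and convex functions from `I` to `I`. -/
def NC : Set (I01 → I01) := {f | NormalFn f ∧ ConvexFn f}

/-- Characteristic function of a subset of `I`. -/
def ind (B : Set I01) : I01 → I01 := fun x => if x ∈ B then 1 else 0

/-- `(f ⊓ g)(x) = sup {min (f y) (g z) | min y z = x}`. -/
def meet (f g : I01 → I01) : I01 → I01 := fun x =>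
  sSup {v | ∃ y z : I01, min y z = x ∧ v = min (f y) (g z)}

/-- The partial order `f ⊑ g` iff `f ⊓ g = f`. -/
def sqle (f g : I01 → I01) : Prop := meet f g = f

/-- `η_{f,g}`. -/
def etaLG (f g : I01 → I01) : I01 :=
  min (sInf {x | funL f x = 1}) (sInf {x | funL g x = 1})

/-- `ξ_{f,g}`. -/
def xiLG (f g : I01 → I01) : I01 :=
  min (sSup {x | funR f x = 1}) (sSup {x | funR g x = 1})

/-- The operation `✶`. -/
def starOp (f g : I01 → I01) : I01 → I01 :=
  if f = ind {1} then g
  else if g = ind {1} then f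
  else fun t =>
    if t < etaLG f g then max (funL f t) (funL g t)
    else if t < xiLG f g then 1
    else if t = xiLG f g then min (funR f (xiLG f g)) (funR g (xiLG f g))
    else 0

/-- A t-norm on `I`. -/
structure IsTnormI (op : I01 → I01 → I01) : Prop where
  comm : ∀ x y : I01, op x y = op y x
  assoc : ∀ x y z : I01, op (op x y) z = op x (op y z)
  mono : ∀ x y z : I01, x ≤ y → op x z ≤ op y z ∧ op z x ≤ op z y
  one_op : ∀ x : I01, op 1 x = x
  op_one : ∀ x : I01, op x 1 = x

/-- A t-conorm on `I`. -/
structure IsTconormI (op : I01 → I01 → I01) : Prop where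
  comm : ∀ x y : I01, op x y = op y x
  assoc : ∀ x y z : I01, op (op x y) z = op x (op y z)
  mono : ∀ x y z : I01, x ≤ y → op x z ≤ op y z ∧ op z x ≤ op z y
  zero_op : ∀ x : I01, op 0 x = x
  op_zero : ∀ x : I01, op x 0 = x

/-- The convolution operation `(f ⋏ g)(x) = sup {st (f y) (g z) | tri y z = x}`. -/
def conv (st tri : I01 → I01 → I01) (f g : I01 → I01) : I01 → I01 := fun x =>
  sSup {v | ∃ y z : I01, tri y z = x ∧ v = st (f y) (g z)}

/-- Complementation `(¬ f)(x) = f (1 - x)`. -/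
def negf (f : I01 → I01) : I01 → I01 := fun x => f (unitInterval.symm x)

/-- The dual operation `f ◇^∁ g = ¬((¬f) ◇ (¬g))`. -/
def dualOp (op : (I01 → I01) → (I01 → I01) → (I01 → I01)) :
    (I01 → I01) → (I01 → I01) → (I01 → I01) :=
  fun f g => negf (op (negf f) (negf g))

/-- A t-norm on `L` according to the basic axioms (O1)--(O4). -/
def IsTnormOnL (T : (I01 → I01) → (I01 → I01) → (I01 → I01)) : Prop :=
  (∀ f ∈ NC, ∀ g ∈ NC, T f g = T g f) ∧
  (∀ f ∈ NC, ∀ g ∈ NC, ∀ h ∈ NC, T (T f g) h = T f (T g h)) ∧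
  (∀ f ∈ NC, T f (ind {1}) = f) ∧
  (∀ f ∈ NC, ∀ g ∈ NC, ∀ h ∈ NC, sqle f g → sqle (T f h) (T g h))

/-- A t-conorm on `L` according to the basic axioms (O1), (O2), (O3'), (O4). -/
def IsTconormOnL (S : (I01 → I01) → (I01 → I01) → (I01 → I01)) : Prop :=
  (∀ f ∈ NC, ∀ g ∈ NC, S f g = S g f) ∧
  (∀ f ∈ NC, ∀ g ∈ NC, ∀ h ∈ NC, S (S f g) h = S f (S g h)) ∧
  (∀ f ∈ NC, S f (ind {0}) = f) ∧
  (∀ f ∈ NC, ∀ g ∈ NC, ∀ h ∈ NC, sqle f g → sqle (S f h) (S g h))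

/-- A `t_r`-norm on `L`: an operation on `L` satisfying axioms (O1)--(O7). -/
def IsTrNorm (T : (I01 → I01) → (I01 → I01) → (I01 → I01)) : Prop :=
  (∀ f ∈ NC, ∀ g ∈ NC, T f g ∈ NC) ∧
  (∀ f ∈ NC, ∀ g ∈ NC, T f g = T g f) ∧
  (∀ f ∈ NC, ∀ g ∈ NC, ∀ h ∈ NC, T (T f g) h = T f (T g h)) ∧
  (∀ f ∈ NC, T f (ind {1}) = f) ∧
  (∀ f ∈ NC, ∀ g ∈ NC, ∀ h ∈ NC, sqle f g → sqle (T f h) (T g h)) ∧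
  (∀ a b : I01, a ≤ b → T (ind (Set.Icc 0 1)) (ind (Set.Icc a b)) = ind (Set.Icc 0 b)) ∧
  (∀ x₁ x₂ : I01, ∃ x₃ : I01, T (ind {x₁}) (ind {x₂}) = ind {x₃}) ∧
  (∀ a₁ b₁ a₂ b₂ : I01, a₁ ≤ b₁ → a₂ ≤ b₂ →
    ∃ a₃ b₃ : I01, a₃ ≤ b₃ ∧
      T (ind (Set.Icc a₁ b₁)) (ind (Set.Icc a₂ b₂)) = ind (Set.Icc a₃ b₃))

/-- A `t_r`-conorm on `L`: an operation on `L` satisfying axioms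
(O1), (O2), (O3'), (O4), (O5'), (O6), (O7). -/
def IsTrConorm (S : (I01 → I01) → (I01 → I01) → (I01 → I01)) : Prop :=
  (∀ f ∈ NC, ∀ g ∈ NC, S f g ∈ NC) ∧
  (∀ f ∈ NC, ∀ g ∈ NC, S f g = S g f) ∧
  (∀ f ∈ NC, ∀ g ∈ NC, ∀ h ∈ NC, S (S f g) h = S f (S g h)) ∧
  (∀ f ∈ NC, S f (ind {0}) = f) ∧
  (∀ f ∈ NC, ∀ g ∈ NC, ∀ h ∈ NC, sqle f g → sqle (S f h) (S g h)) ∧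
  (∀ a b : I01, a ≤ b → S (ind (Set.Icc 0 1)) (ind (Set.Icc a b)) = ind (Set.Icc a 1)) ∧
  (∀ x₁ x₂ : I01, ∃ x₃ : I01, S (ind {x₁}) (ind {x₂}) = ind {x₃}) ∧
  (∀ a₁ b₁ a₂ b₂ : I01, a₁ ≤ b₁ → a₂ ≤ b₂ →
    ∃ a₃ b₃ : I01, a₃ ≤ b₃ ∧
      S (ind (Set.Icc a₁ b₁)) (ind (Set.Icc a₂ b₂)) = ind (Set.Icc a₃ b₃))

section Envelopes

variable {f g : I01 → I01} {s t x y : I01}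

theorem le_funL (h : y ≤ x) : f y ≤ funL f x := le_sSup ⟨y, h, rfl⟩

theorem le_funR (h : x ≤ y) : f y ≤ funR f x := le_sSup ⟨y, h, rfl⟩

theorem funL_le (h : ∀ y ≤ x, f y ≤ s) : funL f x ≤ s := by
  refine sSup_le ?_
  rintro _ ⟨y, hy, rfl⟩
  exact h y hy

theorem funR_le (h : ∀ y, x ≤ y → f y ≤ s) : funR f x ≤ s := by
  refine sSup_le ?_
  rintro _ ⟨y, hy, rfl⟩
  exact h y hy

theorem funL_mono (h : x ≤ y) : funL f x ≤ funL f y :=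
  funL_le fun _ hz => le_funL (hz.trans h)

theorem funR_anti (h : x ≤ y) : funR f y ≤ funR f x :=
  funR_le fun _ hz => le_funR (h.trans hz)

theorem NormalFn.one_le (hf : NormalFn f) (h : ∀ x, f x ≤ s) : 1 ≤ s := by
  rw [← hf]
  refine sSup_le ?_
  rintro _ ⟨y, rfl⟩
  exact h y

theorem NormalFn.of_eq_one (h : f x = 1) : NormalFn f :=
  le_antisymm unitInterval.le_one' (h ▸ le_sSup ⟨x, rfl⟩)

theorem NormalFn.max_funL_funR (hf : NormalFn f) (x : I01) :
    max (funL f x) (funR f x) = 1 := by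
  refine le_antisymm unitInterval.le_one' (hf.one_le fun y => ?_)
  rcases le_total y x with h | h
  · exact le_max_of_le_left (le_funL h)
  · exact le_max_of_le_right (le_funR h)

theorem NormalFn.funR_eq_one (hf : NormalFn f) (h : funL f x < 1) : funR f x = 1 := by
  rcases max_choice (funL f x) (funR f x) with h' | h' <;> rw [hf.max_funL_funR] at h'
  · exact absurd h'.symm h.ne
  · exact h'.symm

theorem NormalFn.funL_eq_one (hf : NormalFn f) (h : funR f x < 1) : funL f x = 1 := by
  by_contra hne
  exact h.ne (hf.funR_eq_one (lt_of_le_of_ne unitInterval.le_one' hne))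

theorem ConvexFn.min_funL_funR (hf : ConvexFn f) (x : I01) :
    min (funL f x) (funR f x) = f x := by
  refine le_antisymm ?_ (le_min (le_funL le_rfl) (le_funR le_rfl))
  by_contra! h
  obtain ⟨h₁, h₂⟩ := lt_min_iff.1 h
  obtain ⟨_, ⟨y, hy, rfl⟩, hy'⟩ := lt_sSup_iff.1 h₁
  obtain ⟨_, ⟨z, hz, rfl⟩, hz'⟩ := lt_sSup_iff.1 h₂
  exact (lt_min hy' hz').not_ge (hf y x z hy hz)

/-- The left end of the core of `f`. -/
def coreLeft (f : I01 → I01) : I01 := sInf {x | funL f x = 1}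

/-- The right end of the core of `f`. -/
def coreRight (f : I01 → I01) : I01 := sSup {x | funR f x = 1}

theorem funL_lt_one (h : x < coreLeft f) : funL f x < 1 :=
  lt_of_le_of_ne unitInterval.le_one' fun hx => (sInf_le (a := x) hx).not_gt h

theorem funR_eq_one (h : x < coreRight f) : funR f x = 1 := by
  obtain ⟨y, hy, hxy⟩ := lt_sSup_iff.1 h
  exact le_antisymm unitInterval.le_one' (le_of_eq_of_le hy.symm (funR_anti hxy.le))

theorem NormalFn.coreLeft_le_coreRight (hf : NormalFn f) : coreLeft f ≤ coreRight f :=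
  le_of_forall_lt_imp_le_of_dense fun _ hx => le_sSup (hf.funR_eq_one (funL_lt_one hx))

theorem coreLeft_anti (h : ∀ x, funL g x ≤ funL f x) : coreLeft f ≤ coreLeft g :=
  sInf_le_sInf fun x hx => le_antisymm unitInterval.le_one' (le_of_eq_of_le hx.symm (h x))

theorem coreRight_mono (h : ∀ x, funR f x ≤ funR g x) : coreRight f ≤ coreRight g :=
  sSup_le_sSup fun x hx => le_antisymm unitInterval.le_one' (le_of_eq_of_le hx.symm (h x))

theorem meet_apply (f g : I01 → I01) (x : I01) :
    meet f g x = max (min (f x) (funR g x)) (min (funR f x) (g x)) := by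
  apply le_antisymm
  · refine sSup_le ?_
    rintro _ ⟨y, z, rfl, rfl⟩
    rcases le_total y z with h | h
    · rw [min_eq_left h]
      exact le_max_of_le_left (min_le_min le_rfl (le_funR h))
    · rw [min_eq_right h]
      exact le_max_of_le_right (min_le_min (le_funR h) le_rfl)
  · by_contra! h
    rcases lt_max_iff.1 h with h | h <;> obtain ⟨h₁, h₂⟩ := lt_min_iff.1 h
    · obtain ⟨_, ⟨z, hz, rfl⟩, hz'⟩ := lt_sSup_iff.1 h₂
      exact (lt_min h₁ hz').not_ge (le_sSup ⟨x, z, min_eq_left hz, rfl⟩)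
    · obtain ⟨_, ⟨z, hz, rfl⟩, hz'⟩ := lt_sSup_iff.1 h₁
      exact (lt_min hz' h₂).not_ge (le_sSup ⟨z, x, min_eq_right hz, rfl⟩)

theorem sqle_iff (hf : f ∈ NC) :
    sqle f g ↔ (∀ x, funR f x ≤ funR g x) ∧ ∀ x, funL g x ≤ funL f x := by
  constructor
  · intro h
    have h' : ∀ x, max (min (f x) (funR g x)) (min (funR f x) (g x)) = f x := fun x => by
      rw [← meet_apply, h]
    constructor
    · refine fun x => funR_le fun y hy => le_trans ?_ (funR_anti hy)
      rw [← h' y]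
      exact max_le (min_le_right _ _) ((min_le_right _ _).trans (le_funR le_rfl))
    · refine fun x => funL_le fun y hy => le_trans ?_ (funL_mono hy)
      rcases le_or_gt (g y) (funR f y) with hgf | hgf
      · refine le_trans ?_ (le_funL le_rfl)
        rw [← h' y, min_eq_right hgf]
        exact le_max_right _ _
      · rw [hf.1.funL_eq_one (hgf.trans_le unitInterval.le_one')]
        exact unitInterval.le_one'
  · rintro ⟨hR, hL⟩
    funext x
    rw [meet_apply, min_eq_left ((le_funR le_rfl).trans (hR x)), max_eq_left]
    conv_rhs => rw [← hf.2.min_funL_funR x]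
    rw [min_comm]
    exact min_le_min ((le_funL le_rfl).trans (hL x)) le_rfl

end Envelopes

section Indicators

variable {a b x : I01}

theorem ind_Icc_self (x : I01) : ind (Set.Icc x x) = ind {x} := by rw [Set.Icc_self]

theorem ind_mem_NC {B : Set I01} (hB : B.OrdConnected) (hne : B.Nonempty) : ind B ∈ NC := by
  obtain ⟨x, hx⟩ := hne
  refine ⟨NormalFn.of_eq_one (x := x) (by simp [ind, hx]), fun x y z hxy hyz => ?_⟩
  by_cases hx : x ∈ B
  · by_cases hz : z ∈ B
    · simp [ind, hB.out hx hz ⟨hxy, hyz⟩, unitInterval.le_one']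
    · simp [ind, hz]
  · simp [ind, hx]

theorem ind_Icc_mem_NC (h : a ≤ b) : ind (Set.Icc a b) ∈ NC :=
  ind_mem_NC Set.ordConnected_Icc (Set.nonempty_Icc.2 h)

theorem ind_singleton_mem_NC (x : I01) : ind {x} ∈ NC := by
  rw [← ind_Icc_self]
  exact ind_Icc_mem_NC le_rfl

theorem funL_ind_Icc (h : a ≤ b) (x : I01) :
    funL (ind (Set.Icc a b)) x = if a ≤ x then 1 else 0 := by
  split_ifs with hx
  · refine le_antisymm unitInterval.le_one' ?_
    have := le_funL (f := ind (Set.Icc a b)) hx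
    simpa [ind, h] using this
  · refine le_antisymm (funL_le fun y hy => ?_) unitInterval.nonneg'
    have : ¬ a ≤ y := fun h' => hx (h'.trans hy)
    simp [ind, this]

theorem funR_ind_Icc (h : a ≤ b) (x : I01) :
    funR (ind (Set.Icc a b)) x = if x ≤ b then 1 else 0 := by
  split_ifs with hx
  · refine le_antisymm unitInterval.le_one' ?_
    have := le_funR (f := ind (Set.Icc a b)) hx
    simpa [ind, h] using this
  · refine le_antisymm (funR_le fun y hy => ?_) unitInterval.nonneg'
    have : ¬ y ≤ b := fun h' => hx (hy.trans h')
    simp [ind, this]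

theorem coreLeft_ind_Icc (h : a ≤ b) : coreLeft (ind (Set.Icc a b)) = a := by
  have : {x | funL (ind (Set.Icc a b)) x = 1} = Set.Ici a := by
    ext x
    simp [funL_ind_Icc h]
  rw [coreLeft, this, csInf_Ici]

theorem coreRight_ind_Icc (h : a ≤ b) : coreRight (ind (Set.Icc a b)) = b := by
  have : {x | funR (ind (Set.Icc a b)) x = 1} = Set.Iic b := by
    ext x
    simp [funR_ind_Icc h]
  rw [coreRight, this, csSup_Iic]

theorem eq_ind_one_iff {f : I01 → I01} (hf : NormalFn f) :
    f = ind {1} ↔ ∀ x < 1, f x ≤ 0 := by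
  constructor
  · rintro rfl x hx
    simp [ind, hx.ne]
  · intro h
    have h1 : f 1 = 1 := le_antisymm unitInterval.le_one' <| hf.one_le fun x => by
      rcases (unitInterval.le_one' (t := x)).lt_or_eq with hx | rfl
      · exact (h x hx).trans unitInterval.nonneg'
      · exact le_rfl
    funext x
    rcases (unitInterval.le_one' (t := x)).lt_or_eq with hx | rfl
    · simpa [ind, hx.ne] using le_antisymm (h x hx) unitInterval.nonneg'
    · simp [ind, h1]

end Indicators

section Star

variable {f g h : I01 → I01} {t : I01}

theorem etaLG_eq (f g : I01 → I01) : etaLG f g = min (coreLeft f) (coreLeft g) := rfl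

theorem xiLG_eq (f g : I01 → I01) : xiLG f g = min (coreRight f) (coreRight g) := rfl

theorem etaLG_le_xiLG (hf : f ∈ NC) (hg : g ∈ NC) : etaLG f g ≤ xiLG f g :=
  min_le_min hf.1.coreLeft_le_coreRight hg.1.coreLeft_le_coreRight

/-- The generic branch of `✶`. -/
def starCore (f g : I01 → I01) (t : I01) : I01 :=
  if t < etaLG f g then max (funL f t) (funL g t)
  else if t < xiLG f g then 1
  else if t = xiLG f g then min (funR f (xiLG f g)) (funR g (xiLG f g))
  else 0

theorem starOp_of_ne (hf : f ≠ ind {1}) (hg : g ≠ ind {1}) : starOp f g = starCore f g := by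
  simp only [starOp, if_neg hf, if_neg hg]
  rfl

theorem ind_one_starOp (g : I01 → I01) : starOp (ind {1}) g = g := by simp [starOp]

theorem starOp_ind_one (f : I01 → I01) : starOp f (ind {1}) = f := by
  by_cases hf : f = ind {1} <;> simp [starOp, hf]

theorem starCore_of_lt_eta (ht : t < etaLG f g) :
    starCore f g t = max (funL f t) (funL g t) := by simp [starCore, ht]

theorem starCore_of_lt_xi (h₁ : etaLG f g ≤ t) (h₂ : t < xiLG f g) : starCore f g t = 1 := by
  simp [starCore, h₁.not_gt, h₂]

theorem starCore_xi (hf : f ∈ NC) (hg : g ∈ NC) :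
    starCore f g (xiLG f g) = min (funR f (xiLG f g)) (funR g (xiLG f g)) := by
  simp [starCore, (etaLG_le_xiLG hf hg).not_gt]

theorem starCore_of_xi_lt (hf : f ∈ NC) (hg : g ∈ NC) (ht : xiLG f g < t) :
    starCore f g t = 0 := by
  simp [starCore, ((etaLG_le_xiLG hf hg).trans ht.le).not_gt, ht.not_gt, ht.ne']

theorem starCore_comm (f g : I01 → I01) : starCore f g = starCore g f := by
  have hη : etaLG f g = etaLG g f := min_comm _ _
  have hξ : xiLG f g = xiLG g f := min_comm _ _
  funext t
  simp only [starCore, hη, hξ, max_comm (funL f t), min_comm (funR f _)]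

theorem funR_eq_one_of_starCore_le (hf : f ∈ NC) {s : I01} (hs : s < 1)
    (hη : etaLG f g = xiLG f g) (h : ∀ t, starCore f g t ≤ s) : funR f (xiLG f g) = 1 := by
  by_contra hne
  have hlt : funR f (xiLG f g) < 1 := lt_of_le_of_ne unitInterval.le_one' hne
  refine (max_lt hs hlt).not_ge (hf.1.one_le fun x => ?_)
  rcases lt_or_ge x (xiLG f g) with hx | hx
  · refine le_max_of_le_left (le_trans ?_ (h x))
    rw [starCore_of_lt_eta (hη ▸ hx)]
    exact le_max_of_le_left (le_funL le_rfl)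
  · exact le_max_of_le_right (le_funR hx)

theorem normalFn_starCore (hf : f ∈ NC) (hg : g ∈ NC) : NormalFn (starCore f g) := by
  rcases (etaLG_le_xiLG hf hg).lt_or_eq with hlt | heq
  · exact NormalFn.of_eq_one (starCore_of_lt_xi le_rfl hlt)
  · by_contra hne
    have hs := lt_of_le_of_ne unitInterval.le_one' hne
    have hb : ∀ t, starCore f g t ≤ sSup (Set.range (starCore f g)) := fun t => le_sSup ⟨t, rfl⟩
    have h₁ := funR_eq_one_of_starCore_le hf hs heq hb
    have h₂ : funR g (xiLG f g) = 1 := by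
      rw [xiLG_eq, min_comm, ← xiLG_eq]
      refine funR_eq_one_of_starCore_le hg hs ?_ fun t => ?_
      · rwa [xiLG_eq, etaLG_eq, min_comm, ← etaLG_eq, min_comm, ← xiLG_eq]
      · rw [starCore_comm g f]
        exact hb t
    have := hb (xiLG f g)
    rw [starCore_xi hf hg, h₁, h₂, min_self] at this
    exact hs.not_ge this

theorem convexFn_starCore (hf : f ∈ NC) (hg : g ∈ NC) : ConvexFn (starCore f g) := by
  intro x y z hxy hyz
  rcases lt_or_ge y (etaLG f g) with hy | hy
  · rw [starCore_of_lt_eta hy, starCore_of_lt_eta (hxy.trans_lt hy)]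
    exact min_le_of_left_le (max_le_max (funL_mono hxy) (funL_mono hxy))
  rcases lt_or_ge y (xiLG f g) with hy' | hy'
  · rw [starCore_of_lt_xi hy hy']
    exact unitInterval.le_one'
  rcases hyz.lt_or_eq with hlt | rfl
  · rw [starCore_of_xi_lt hf hg (hy'.trans_lt hlt)]
    exact min_le_of_right_le unitInterval.nonneg'
  · exact min_le_right _ _

theorem starCore_mem_NC (hf : f ∈ NC) (hg : g ∈ NC) : starCore f g ∈ NC :=
  ⟨normalFn_starCore hf hg, convexFn_starCore hf hg⟩

theorem funL_starCore_of_lt (ht : t < etaLG f g) :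
    funL (starCore f g) t = max (funL f t) (funL g t) := by
  refine le_antisymm (funL_le fun y hy => ?_) ?_
  · rw [starCore_of_lt_eta (hy.trans_lt ht)]
    exact max_le_max (funL_mono hy) (funL_mono hy)
  · rw [← starCore_of_lt_eta ht]
    exact le_funL le_rfl

theorem funL_starCore_of_le (hf : f ∈ NC) (hg : g ∈ NC) (ht : etaLG f g ≤ t) :
    funL (starCore f g) t = 1 := by
  refine le_antisymm unitInterval.le_one' ?_
  rcases (etaLG_le_xiLG hf hg).lt_or_eq with hlt | heq
  · rw [← starCore_of_lt_xi le_rfl hlt]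
    exact le_funL ht
  · refine (normalFn_starCore hf hg).one_le fun z => ?_
    rcases le_or_gt z t with hz | hz
    · exact le_funL hz
    · rw [starCore_of_xi_lt hf hg ((heq ▸ ht).trans_lt hz)]
      exact unitInterval.nonneg'

theorem max_funL_lt_one (ht : t < etaLG f g) : max (funL f t) (funL g t) < 1 :=
  max_lt (funL_lt_one (ht.trans_le (min_le_left _ _)))
    (funL_lt_one (ht.trans_le (min_le_right _ _)))

theorem min_funR_eq_one (ht : t < xiLG f g) : min (funR f t) (funR g t) = 1 := by
  rw [funR_eq_one (ht.trans_le (min_le_left _ _)),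
    funR_eq_one (ht.trans_le (min_le_right _ _)), min_self]

theorem funR_starCore_of_le (hf : f ∈ NC) (hg : g ∈ NC) (ht : t ≤ xiLG f g) :
    funR (starCore f g) t = min (funR f t) (funR g t) := by
  rcases ht.lt_or_eq with hlt | rfl
  · rw [min_funR_eq_one hlt]
    rcases lt_or_ge t (etaLG f g) with hη | hη
    · refine (normalFn_starCore hf hg).funR_eq_one ?_
      rw [funL_starCore_of_lt hη]
      exact max_funL_lt_one hη
    · refine le_antisymm unitInterval.le_one' ?_
      rw [← starCore_of_lt_xi hη hlt]
      exact le_funR le_rfl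
  · rw [← starCore_xi hf hg]
    refine le_antisymm (funR_le fun y hy => ?_) (le_funR le_rfl)
    rcases hy.lt_or_eq with hy | rfl
    · rw [starCore_of_xi_lt hf hg hy]
      exact unitInterval.nonneg'
    · exact le_rfl

theorem funR_starCore_of_lt (hf : f ∈ NC) (hg : g ∈ NC) (ht : xiLG f g < t) :
    funR (starCore f g) t = 0 := by
  refine le_antisymm (funR_le fun y hy => ?_) unitInterval.nonneg'
  rw [starCore_of_xi_lt hf hg (ht.trans_le hy)]

theorem coreLeft_starCore (hf : f ∈ NC) (hg : g ∈ NC) :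
    coreLeft (starCore f g) = etaLG f g := by
  refine le_antisymm (sInf_le (funL_starCore_of_le hf hg le_rfl)) (le_sInf fun x hx => ?_)
  by_contra! hlt
  rw [Set.mem_ofPred_eq, funL_starCore_of_lt hlt] at hx
  exact (max_funL_lt_one hlt).ne hx

theorem coreRight_starCore (hf : f ∈ NC) (hg : g ∈ NC) :
    coreRight (starCore f g) = xiLG f g := by
  refine le_antisymm (sSup_le fun x hx => ?_)
    (le_of_forall_lt_imp_le_of_dense fun x hx => le_sSup ?_)
  · by_contra! hlt
    rw [Set.mem_ofPred_eq, funR_starCore_of_lt hf hg hlt] at hx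
    exact zero_ne_one hx
  · rw [Set.mem_ofPred_eq, funR_starCore_of_le hf hg hx.le, min_funR_eq_one hx]

theorem starCore_ne_ind_one (hf : f ∈ NC) (hg : g ∈ NC) (hf1 : f ≠ ind {1}) :
    starCore f g ≠ ind {1} := by
  intro h
  refine hf1 ((eq_ind_one_iff hf.1).2 fun x hx => ?_)
  have hx0 : starCore f g x = 0 := by simp [h, ind, hx.ne]
  have hξ : xiLG f g = 1 := by
    refine le_antisymm unitInterval.le_one' ?_
    by_contra! hlt
    have := starCore_of_xi_lt hf hg hlt
    simp [h, ind] at this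
  have hη : x < etaLG f g := by
    by_contra! hle
    rw [starCore_of_lt_xi hle (hξ ▸ hx)] at hx0
    exact one_ne_zero hx0
  rw [← hx0, starCore_of_lt_eta hη]
  exact le_max_of_le_left (le_funL le_rfl)

theorem starCore_starCore_apply (hf : f ∈ NC) (hg : g ∈ NC) (h : I01 → I01) (t : I01) :
    starCore (starCore f g) h t =
      if t < min (etaLG f g) (coreLeft h) then max (max (funL f t) (funL g t)) (funL h t)
      else if t < min (xiLG f g) (coreRight h) then 1
      else if t = min (xiLG f g) (coreRight h) then
        min (min (funR f t) (funR g t)) (funR h t)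
      else 0 := by
  have hη : etaLG (starCore f g) h = min (etaLG f g) (coreLeft h) := by
    rw [etaLG_eq, coreLeft_starCore hf hg]
  have hξ : xiLG (starCore f g) h = min (xiLG f g) (coreRight h) := by
    rw [xiLG_eq, coreRight_starCore hf hg]
  rw [starCore, hη, hξ]
  split_ifs with h₁ h₂ h₃
  · rw [funL_starCore_of_lt (h₁.trans_le (min_le_left _ _))]
  · rfl
  · rw [← h₃, funR_starCore_of_le hf hg (h₃.trans_le (min_le_left _ _))]
  · rfl

theorem starCore_assoc (hf : f ∈ NC) (hg : g ∈ NC) (hh : h ∈ NC) :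
    starCore (starCore f g) h = starCore f (starCore g h) := by
  funext t
  rw [starCore_comm f (starCore g h), starCore_starCore_apply hf hg, starCore_starCore_apply hg hh]
  simp only [etaLG_eq, xiLG_eq, min_assoc, max_assoc, min_comm (coreLeft f),
    min_comm (coreRight f), min_comm (funR f t), max_comm (funL f t)]

theorem sqle_starCore_left (hf : f ∈ NC) (hg : g ∈ NC) : sqle (starCore f g) g := by
  refine (sqle_iff (starCore_mem_NC hf hg)).2 ⟨fun x => ?_, fun x => ?_⟩
  · rcases le_or_gt x (xiLG f g) with hx | hx
    · rw [funR_starCore_of_le hf hg hx]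
      exact min_le_right _ _
    · rw [funR_starCore_of_lt hf hg hx]
      exact unitInterval.nonneg'
  · rcases lt_or_ge x (etaLG f g) with hx | hx
    · rw [funL_starCore_of_lt hx]
      exact le_max_right _ _
    · rw [funL_starCore_of_le hf hg hx]
      exact unitInterval.le_one'

theorem starCore_mono (hf : f ∈ NC) (hg : g ∈ NC) (hh : h ∈ NC) (hfg : sqle f g) :
    sqle (starCore f h) (starCore g h) := by
  obtain ⟨hR, hL⟩ := (sqle_iff hf).1 hfg
  have hη : etaLG f h ≤ etaLG g h := min_le_min (coreLeft_anti hL) le_rfl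
  have hξ : xiLG f h ≤ xiLG g h := min_le_min (coreRight_mono hR) le_rfl
  refine (sqle_iff (starCore_mem_NC hf hh)).2 ⟨fun x => ?_, fun x => ?_⟩
  · rcases le_or_gt x (xiLG f h) with hx | hx
    · rw [funR_starCore_of_le hf hh hx, funR_starCore_of_le hg hh (hx.trans hξ)]
      exact min_le_min (hR x) le_rfl
    · rw [funR_starCore_of_lt hf hh hx]
      exact unitInterval.nonneg'
  · rcases lt_or_ge x (etaLG f h) with hx | hx
    · rw [funL_starCore_of_lt hx, funL_starCore_of_lt (hx.trans_le hη)]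
      exact max_le_max (hL x) le_rfl
    · rw [funL_starCore_of_le hf hh hx]
      exact unitInterval.le_one'

theorem eq_ind_one_of_sqle (hg : g ∈ NC) (h : sqle (ind {1}) g) : g = ind {1} := by
  obtain ⟨-, hL⟩ := (sqle_iff (ind_singleton_mem_NC 1)).1 h
  refine (eq_ind_one_iff hg.1).2 fun x hx => ((le_funL le_rfl).trans (hL x)).trans ?_
  rw [← ind_Icc_self, funL_ind_Icc le_rfl, if_neg hx.not_ge]

theorem sqle_refl (hf : f ∈ NC) : sqle f f :=
  (sqle_iff hf).2 ⟨fun _ => le_rfl, fun _ => le_rfl⟩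

theorem starOp_mem_NC (hf : f ∈ NC) (hg : g ∈ NC) : starOp f g ∈ NC := by
  by_cases hf1 : f = ind {1}
  · rwa [hf1, ind_one_starOp]
  by_cases hg1 : g = ind {1}
  · rwa [hg1, starOp_ind_one]
  rw [starOp_of_ne hf1 hg1]
  exact starCore_mem_NC hf hg

theorem starOp_comm (f g : I01 → I01) : starOp f g = starOp g f := by
  by_cases hf1 : f = ind {1}
  · rw [hf1, ind_one_starOp, starOp_ind_one]
  by_cases hg1 : g = ind {1}
  · rw [hg1, ind_one_starOp, starOp_ind_one]
  rw [starOp_of_ne hf1 hg1, starOp_of_ne hg1 hf1, starCore_comm]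

theorem starOp_assoc (hf : f ∈ NC) (hg : g ∈ NC) (hh : h ∈ NC) :
    starOp (starOp f g) h = starOp f (starOp g h) := by
  by_cases hf1 : f = ind {1}
  · rw [hf1, ind_one_starOp, ind_one_starOp]
  by_cases hg1 : g = ind {1}
  · rw [hg1, ind_one_starOp, starOp_ind_one]
  by_cases hh1 : h = ind {1}
  · rw [hh1, starOp_ind_one, starOp_ind_one]
  rw [starOp_of_ne hf1 hg1, starOp_of_ne hg1 hh1,
    starOp_of_ne (starCore_ne_ind_one hf hg hf1) hh1,
    starOp_of_ne hf1 (starCore_ne_ind_one hg hh hg1), starCore_assoc hf hg hh]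

theorem starOp_mono (hf : f ∈ NC) (hg : g ∈ NC) (hh : h ∈ NC) (hfg : sqle f g) :
    sqle (starOp f h) (starOp g h) := by
  by_cases hh1 : h = ind {1}
  · rwa [hh1, starOp_ind_one, starOp_ind_one]
  by_cases hf1 : f = ind {1}
  · rw [hf1] at hfg ⊢
    rw [eq_ind_one_of_sqle hg hfg]
    exact sqle_refl (starOp_mem_NC (ind_singleton_mem_NC 1) hh)
  by_cases hg1 : g = ind {1}
  · rw [hg1, ind_one_starOp, starOp_of_ne hf1 hh1]
    exact sqle_starCore_left hf hh
  rw [starOp_of_ne hf1 hh1, starOp_of_ne hg1 hh1]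
  exact starCore_mono hf hg hh hfg

theorem ind_Icc_eq_ind_one {a b : I01} (hab : a ≤ b) (h : ind (Set.Icc a b) = ind {1}) :
    a = 1 ∧ b = 1 := by
  have h₁ := coreLeft_ind_Icc hab
  have h₂ := coreRight_ind_Icc hab
  rw [h, ← ind_Icc_self] at h₁ h₂
  rw [coreLeft_ind_Icc le_rfl] at h₁
  rw [coreRight_ind_Icc le_rfl] at h₂
  exact ⟨h₁.symm, h₂.symm⟩

theorem starOp_ind_Icc {a₁ b₁ a₂ b₂ : I01} (h₁ : a₁ ≤ b₁) (h₂ : a₂ ≤ b₂) :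
    starOp (ind (Set.Icc a₁ b₁)) (ind (Set.Icc a₂ b₂)) =
      ind (Set.Icc (min a₁ a₂) (min b₁ b₂)) := by
  by_cases e₁ : ind (Set.Icc a₁ b₁) = ind {1}
  · obtain ⟨rfl, rfl⟩ := ind_Icc_eq_ind_one h₁ e₁
    rw [e₁, ind_one_starOp, min_eq_right unitInterval.le_one', min_eq_right unitInterval.le_one']
  by_cases e₂ : ind (Set.Icc a₂ b₂) = ind {1}
  · obtain ⟨rfl, rfl⟩ := ind_Icc_eq_ind_one h₂ e₂
    rw [e₂, starOp_ind_one, min_eq_left unitInterval.le_one', min_eq_left unitInterval.le_one']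
  rw [starOp_of_ne e₁ e₂]
  have hη : etaLG (ind (Set.Icc a₁ b₁)) (ind (Set.Icc a₂ b₂)) = min a₁ a₂ := by
    rw [etaLG_eq, coreLeft_ind_Icc h₁, coreLeft_ind_Icc h₂]
  have hξ : xiLG (ind (Set.Icc a₁ b₁)) (ind (Set.Icc a₂ b₂)) = min b₁ b₂ := by
    rw [xiLG_eq, coreRight_ind_Icc h₁, coreRight_ind_Icc h₂]
  funext t
  simp only [starCore, hη, hξ, funL_ind_Icc h₁, funL_ind_Icc h₂, funR_ind_Icc h₁,
    funR_ind_Icc h₂, min_le_left, min_le_right, if_true, min_self, ind, Set.mem_Icc]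
  split_ifs with c₁ c₂ c₃ c₄ c₅ <;> grind

theorem isTrNorm_starOp : IsTrNorm starOp := by
  refine ⟨fun f hf g hg => starOp_mem_NC hf hg, fun f _ g _ => starOp_comm f g,
    fun f hf g hg h hh => starOp_assoc hf hg hh, fun f _ => starOp_ind_one f,
    fun f hf g hg h hh => starOp_mono hf hg hh, fun a b hab => ?_, fun x₁ x₂ => ?_,
    fun a₁ b₁ a₂ b₂ h₁ h₂ => ⟨_, _, min_le_min h₁ h₂, starOp_ind_Icc h₁ h₂⟩⟩
  · rw [starOp_ind_Icc zero_le_one hab, min_eq_left unitInterval.nonneg',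
      min_eq_right unitInterval.le_one']
  · refine ⟨min x₁ x₂, ?_⟩
    rw [← ind_Icc_self x₁, ← ind_Icc_self x₂, starOp_ind_Icc le_rfl le_rfl, ind_Icc_self]

end Star

section Duality

variable {f g : I01 → I01}

theorem negf_negf (f : I01 → I01) : negf (negf f) = f := by
  funext x
  simp [negf]

theorem funL_negf (f : I01 → I01) (x : I01) :
    funL (negf f) x = funR f (unitInterval.symm x) := by
  apply le_antisymm
  · exact funL_le fun y hy => le_funR (unitInterval.symm_le_symm.2 hy)
  · refine funR_le fun y hy => ?_
    have := le_funL (f := negf f) (unitInterval.symm_le_symm.2 hy)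
    simpa [negf] using this

theorem funR_negf (f : I01 → I01) (x : I01) :
    funR (negf f) x = funL f (unitInterval.symm x) := by
  have := funL_negf (negf f) (unitInterval.symm x)
  rw [negf_negf, unitInterval.symm_symm] at this
  exact this.symm

theorem negf_mem_NC (hf : f ∈ NC) : negf f ∈ NC := by
  refine ⟨?_, fun x y z hxy hyz => ?_⟩
  · refine le_antisymm unitInterval.le_one' (hf.1.one_le fun x => le_sSup ?_)
    exact ⟨unitInterval.symm x, by simp [negf]⟩
  · rw [min_comm]
    exact hf.2 _ _ _ (unitInterval.symm_le_symm.2 hyz) (unitInterval.symm_le_symm.2 hxy)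

theorem sqle_negf (hf : f ∈ NC) (hg : g ∈ NC) (h : sqle f g) : sqle (negf g) (negf f) := by
  obtain ⟨hR, hL⟩ := (sqle_iff hf).1 h
  refine (sqle_iff (negf_mem_NC hg)).2 ⟨fun x => ?_, fun x => ?_⟩
  · simpa only [funR_negf] using hL _
  · simpa only [funL_negf] using hR _

theorem negf_ind_Icc (a b : I01) :
    negf (ind (Set.Icc a b)) = ind (Set.Icc (unitInterval.symm b) (unitInterval.symm a)) := by
  funext x
  simp only [negf, ind, Set.mem_Icc, unitInterval.le_symm_comm (i := a),
    unitInterval.symm_le_comm (i := x), and_comm]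

theorem negf_ind_singleton (x : I01) : negf (ind {x}) = ind {unitInterval.symm x} := by
  rw [← ind_Icc_self, negf_ind_Icc, ind_Icc_self]

theorem IsTrNorm.isTrConorm_dualOp {T : (I01 → I01) → (I01 → I01) → (I01 → I01)}
    (hT : IsTrNorm T) : IsTrConorm (dualOp T) := by
  obtain ⟨hmem, hcomm, hassoc, hone, hmono, hIcc, hJ, hK⟩ := hT
  refine ⟨fun f hf g hg => negf_mem_NC (hmem _ (negf_mem_NC hf) _ (negf_mem_NC hg)),
    fun f hf g hg => ?_, fun f hf g hg h hh => ?_, fun f hf => ?_,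
    fun f hf g hg h hh hfg => ?_, fun a b hab => ?_, fun x₁ x₂ => ?_,
    fun a₁ b₁ a₂ b₂ h₁ h₂ => ?_⟩
  · simp only [dualOp, hcomm _ (negf_mem_NC hf) _ (negf_mem_NC hg)]
  · simp only [dualOp, negf_negf,
      hassoc _ (negf_mem_NC hf) _ (negf_mem_NC hg) _ (negf_mem_NC hh)]
  · rw [dualOp, negf_ind_singleton, unitInterval.symm_zero, hone _ (negf_mem_NC hf), negf_negf]
  · have hf' := negf_mem_NC hf
    have hg' := negf_mem_NC hg
    have hh' := negf_mem_NC hh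
    exact sqle_negf (hmem _ hg' _ hh') (hmem _ hf' _ hh')
      (hmono _ hg' _ hf' _ hh' (sqle_negf hf hg hfg))
  · rw [dualOp, negf_ind_Icc, negf_ind_Icc, unitInterval.symm_zero, unitInterval.symm_one,
      hIcc _ _ (unitInterval.symm_le_symm.2 hab), negf_ind_Icc, unitInterval.symm_symm,
      unitInterval.symm_zero]
  · obtain ⟨x₃, h₃⟩ := hJ (unitInterval.symm x₁) (unitInterval.symm x₂)
    exact ⟨unitInterval.symm x₃, by
      rw [dualOp, negf_ind_singleton, negf_ind_singleton, h₃, negf_ind_singleton]⟩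
  · obtain ⟨a₃, b₃, h₃, e₃⟩ := hK _ _ _ _ (unitInterval.symm_le_symm.2 h₁)
      (unitInterval.symm_le_symm.2 h₂)
    exact ⟨_, _, unitInterval.symm_le_symm.2 h₃, by
      rw [dualOp, negf_ind_Icc, negf_ind_Icc, e₃, negf_ind_Icc]⟩

end Duality

section Convolution

/-- The midpoint of `I`. -/
def halfI : I01 := ⟨1 / 2, by norm_num, by norm_num⟩

theorem halfI_pos : 0 < halfI := by
  rw [← Subtype.coe_lt_coe]
  norm_num [halfI]

theorem halfI_lt_one : halfI < 1 := by
  rw [← Subtype.coe_lt_coe]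
  norm_num [halfI]

theorem IsTnormI.conv_one {tri : I01 → I01 → I01} (h : IsTnormI tri) (st : I01 → I01 → I01)
    (f g : I01 → I01) : conv st tri f g 1 = st (f 1) (g 1) := by
  have : {v | ∃ y z : I01, tri y z = 1 ∧ v = st (f y) (g z)} = {st (f 1) (g 1)} := by
    ext v
    constructor
    · rintro ⟨y, z, hyz, rfl⟩
      have hy : y = 1 := le_antisymm unitInterval.le_one' <| by
        rw [← hyz]
        exact (h.mono z 1 y unitInterval.le_one').2.trans_eq (h.op_one y)
      have hz : z = 1 := le_antisymm unitInterval.le_one' <| by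
        rw [← hyz]
        exact (h.mono y 1 z unitInterval.le_one').1.trans_eq (h.one_op z)
      rw [hy, hz]
      rfl
    · rintro rfl
      exact ⟨1, 1, h.one_op 1, rfl⟩
  rw [conv, this, sSup_singleton]

theorem IsTconormI.conv_zero {nab : I01 → I01 → I01} (h : IsTconormI nab)
    (st : I01 → I01 → I01) (f g : I01 → I01) : conv st nab f g 0 = st (f 0) (g 0) := by
  have : {v | ∃ y z : I01, nab y z = 0 ∧ v = st (f y) (g z)} = {st (f 0) (g 0)} := by
    ext v
    constructor
    · rintro ⟨y, z, hyz, rfl⟩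
      have hy : y = 0 := le_antisymm (by
        rw [← hyz]
        exact (h.op_zero y).symm.trans_le (h.mono 0 z y unitInterval.nonneg').2)
          unitInterval.nonneg'
      have hz : z = 0 := le_antisymm (by
        rw [← hyz]
        exact (h.zero_op z).symm.trans_le (h.mono 0 y z unitInterval.nonneg').1)
          unitInterval.nonneg'
      rw [hy, hz]
      rfl
    · rintro rfl
      exact ⟨0, 0, h.zero_op 0, rfl⟩
  rw [conv, this, sSup_singleton]

theorem ind_ne_one_mem_NC : ind {x | x ≠ 1} ∈ NC := by
  refine ind_mem_NC ⟨fun x _ y hy z hz => ?_⟩ ⟨0, zero_ne_one⟩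
  exact (hz.2.trans_lt (lt_of_le_of_ne unitInterval.le_one' hy)).ne

theorem dualOp_ind_ne_one :
    dualOp starOp (ind {x | x ≠ 1}) (ind {x | x ≠ 1}) 1 = 1 := by
  set f := negf (ind {x | x ≠ 1}) with hf
  have hfx : ∀ x, 0 < x → f x = 1 := fun x hx => by
    have : unitInterval.symm x ≠ 1 := fun h => hx.ne' (unitInterval.symm_eq_one.1 h)
    simp [hf, negf, ind, this]
  have hf1 : f ≠ ind {1} := fun h => by
    have := congrFun h halfI
    rw [hfx _ halfI_pos] at this
    simp [ind, halfI_lt_one.ne] at this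
  have hl : coreLeft f = 0 := by
    refine le_antisymm (le_of_forall_gt_imp_ge_of_dense fun x hx => sInf_le ?_)
      unitInterval.nonneg'
    exact le_antisymm unitInterval.le_one' (hfx x hx ▸ le_funL le_rfl)
  have hr : coreRight f = 1 := by
    refine le_antisymm unitInterval.le_one' (le_sSup ?_)
    exact le_antisymm unitInterval.le_one' ((hfx 1 zero_lt_one).symm.trans_le (le_funR le_rfl))
  rw [dualOp, negf, unitInterval.symm_one, starOp_of_ne hf1 hf1]
  apply starCore_of_lt_xi
  · rw [etaLG_eq, hl, min_self]
  · rw [xiLG_eq, hr, min_self]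
    exact zero_lt_one

/-- The function equal to `1` at `1` and to `1 / 2` elsewhere. -/
def halfStep (x : I01) : I01 := if x = 1 then 1 else halfI

theorem halfStep_mem_NC : halfStep ∈ NC := by
  refine ⟨NormalFn.of_eq_one (x := 1) (by simp [halfStep]), fun x y z hxy _ => ?_⟩
  refine min_le_of_left_le ?_
  unfold halfStep
  split_ifs with h₁ h₂
  · exact le_rfl
  · exact absurd (le_antisymm unitInterval.le_one' (h₁ ▸ hxy)) h₂
  · exact unitInterval.le_one'
  · exact le_rfl

theorem halfStep_zero_ne : halfStep 0 ≠ 0 := by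
  rw [halfStep, if_neg zero_ne_one]
  exact halfI_pos.ne'

theorem dualOp_halfStep : dualOp starOp halfStep (ind (Set.Icc 0 1)) 0 = 0 := by
  have hne : negf halfStep ≠ ind {1} := fun h => by
    have := congrFun h 0
    simp [negf, halfStep, ind] at this
  have hr : coreRight (negf halfStep) = 0 := by
    refine le_antisymm (sSup_le fun x hx => ?_) unitInterval.nonneg'
    by_contra! h0
    refine halfI_lt_one.not_ge (le_of_eq_of_le (Eq.symm hx) (funR_le fun y hy => ?_))
    have : unitInterval.symm y ≠ 1 :=
      fun h => (h0.trans_le hy).ne' (unitInterval.symm_eq_one.1 h)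
    simp [negf, halfStep, this]
  have hne' : ind (Set.Icc (0 : I01) 1) ≠ ind {1} := fun h =>
    zero_ne_one (ind_Icc_eq_ind_one zero_le_one h).1
  rw [dualOp, negf_ind_Icc, unitInterval.symm_one, unitInterval.symm_zero, negf,
    unitInterval.symm_zero, starOp_of_ne hne hne']
  apply starCore_of_xi_lt (negf_mem_NC halfStep_mem_NC) (ind_Icc_mem_NC zero_le_one)
  rw [xiLG_eq, hr, min_eq_left unitInterval.nonneg']
  exact zero_lt_one

end Convolution

/-- `✶^∁` is a `t_r`-conorm on `L`, and it cannot be obtained by the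
convolution formulas `⋏` or `⋎`. -/
theorem stmt5 :
    IsTrConorm (dualOp starOp) ∧
    (∀ st tri : I01 → I01 → I01, IsTnormI tri →
      ∃ f ∈ NC, ∃ g ∈ NC, dualOp starOp f g ≠ conv st tri f g) ∧
    (∀ st nab : I01 → I01 → I01, IsTconormI nab →
      ∃ f ∈ NC, ∃ g ∈ NC, dualOp starOp f g ≠ conv st nab f g) := by
  refine ⟨isTrNorm_starOp.isTrConorm_dualOp, fun st tri h => ?_, fun st nab h => ?_⟩
  · by_contra! hc
    have hf : ind {x | x ≠ 1} ∈ NC := ind_ne_one_mem_NC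
    have h0 : ind {0} ∈ NC := ind_singleton_mem_NC 0
    have e₁ := congrFun (hc _ hf _ hf) 1
    have e₂ := congrFun (hc _ h0 _ h0) 1
    rw [h.conv_one] at e₁ e₂
    rw [dualOp_ind_ne_one] at e₁
    rw [isTrNorm_starOp.isTrConorm_dualOp.2.2.2.1 _ h0] at e₂
    simp [ind] at e₁ e₂
    exact zero_ne_one (e₂.trans e₁.symm)
  · by_contra! hc
    have e₁ := congrFun (hc _ halfStep_mem_NC _ (ind_singleton_mem_NC 0)) 0
    have e₂ := congrFun (hc _ halfStep_mem_NC _ (ind_Icc_mem_NC (zero_le_one' I01))) 0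
    rw [h.conv_zero] at e₁ e₂
    rw [isTrNorm_starOp.isTrConorm_dualOp.2.2.2.1 _ halfStep_mem_NC] at e₁
    rw [dualOp_halfStep] at e₂
    have a₁ : ind {0} 0 = 1 := by simp [ind]
    have a₂ : ind (Set.Icc 0 1) 0 = 1 := by simp [ind]
    rw [a₁] at e₁
    rw [a₂, ← e₁] at e₂
    exact halfStep_zero_ne e₂.symm
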